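/- Let Ω = (0, π/2) × (0, ∞) and let C* = {(x,y) ∈ Ω : y = −ln(cos x)} be the right half of the grim reaper curve (the translating soliton of the curve shortening flow). Let P₁, P₂ ∈ C* and let X* be a regular C¹ curve in Ω from P₁ to P₂ whose image is contained in C*. Then for every C¹ curve X in Ω from P₁ to P₂ one has L_φ(X) ≥ L_φ(X*), where φ(x,y) = e^y. That is, the half grim reaper is a weighted length-minimizer for the density e^y. -/

import Mathlib

open Set

/-- Euclidean norm of a vector in `ℝ × ℝ`. -/
noncomputable def elen (v : ℝ × ℝ) : ℝ := Real.sqrt (v.1 ^ 2 + v.2 ^ 2)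

/-- Euclidean dot product on `ℝ × ℝ`. -/
def dotp (v w : ℝ × ℝ) : ℝ := v.1 * w.1 + v.2 * w.2

/-- The gradient `(u_x, u_y)` of `u : ℝ × ℝ → ℝ` at a point. -/
noncomputable def grad (u : ℝ × ℝ → ℝ) (p : ℝ × ℝ) : ℝ × ℝ :=
  (fderiv ℝ u p (1, 0), fderiv ℝ u p (0, 1))

/-- A C¹ curve in `Ω` from `P₁` to `P₂`, parametrized on `[0,1]`. -/
def IsC1CurveIn (Ω : Set (ℝ × ℝ)) (P₁ P₂ : ℝ × ℝ) (X : ℝ → ℝ × ℝ) : Prop :=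
  ContDiffOn ℝ 1 X (Icc 0 1) ∧ (∀ t ∈ Icc (0:ℝ) 1, X t ∈ Ω) ∧ X 0 = P₁ ∧ X 1 = P₂

/-- Regularity: nonvanishing velocity on `[0,1]`. -/
def IsRegularCurve (X : ℝ → ℝ × ℝ) : Prop :=
  ∀ t ∈ Icc (0:ℝ) 1, derivWithin X (Icc 0 1) t ≠ 0

/-- Weighted length `∫₀¹ φ(X(t)) ‖X'(t)‖ dt` with respect to a density `φ`. -/
noncomputable def wLen (φ : ℝ × ℝ → ℝ) (X : ℝ → ℝ × ℝ) : ℝ :=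
  ∫ t in (0:ℝ)..1, φ (X t) * elen (derivWithin X (Icc 0 1) t)

/-- Basic data extracted from a C¹ curve. -/
lemma curve_data {Ω : Set (ℝ × ℝ)} {P₁ P₂ : ℝ × ℝ} {X : ℝ → ℝ × ℝ}
    (hX : IsC1CurveIn Ω P₁ P₂ X) :
    ContinuousOn (derivWithin X (Icc 0 1)) (Icc 0 1) ∧
    (∀ t ∈ Icc (0:ℝ) 1, HasDerivWithinAt (fun t => (X t).1)
      (derivWithin X (Icc 0 1) t).1 (Icc 0 1) t) ∧
    (∀ t ∈ Icc (0:ℝ) 1, HasDerivWithinAt (fun t => (X t).2)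
      (derivWithin X (Icc 0 1) t).2 (Icc 0 1) t) := by
  have hu : UniqueDiffOn ℝ (Icc (0:ℝ) 1) := uniqueDiffOn_Icc zero_lt_one
  have hd : ∀ t ∈ Icc (0:ℝ) 1, HasDerivWithinAt X (derivWithin X (Icc 0 1) t) (Icc 0 1) t :=
    fun t ht => ((hX.1.differentiableOn one_ne_zero) t ht).hasDerivWithinAt
  refine ⟨hX.1.continuousOn_derivWithin hu le_rfl, fun t ht => ?_, fun t ht => ?_⟩
  · exact (hasFDerivAt_fst (𝕜 := ℝ) (p := X t)).comp_hasDerivWithinAt t (hd t ht)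
  · exact (hasFDerivAt_snd (𝕜 := ℝ) (p := X t)).comp_hasDerivWithinAt t (hd t ht)

/-- Continuity of the length integrand. -/
lemma cont_integrand {Ω : Set (ℝ × ℝ)} {P₁ P₂ : ℝ × ℝ} {X : ℝ → ℝ × ℝ}
    (hX : IsC1CurveIn Ω P₁ P₂ X) :
    ContinuousOn (fun t => Real.exp (X t).2 * elen (derivWithin X (Icc 0 1) t)) (Icc 0 1) := by
  have h1 := (curve_data hX).1
  have h2 := hX.1.continuousOn
  unfold elen
  fun_prop

/-- The one-variable part of the calibration potential. -/
noncomputable def calG (y : ℝ) : ℝ :=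
  Real.sqrt (Real.exp (2 * y) - 1) - Real.arctan (Real.sqrt (Real.exp (2 * y) - 1))

lemma calG_deriv {y : ℝ} (hy : 0 < y) :
    HasDerivAt calG (Real.sqrt (Real.exp (2 * y) - 1)) y := by
  have hpos : 0 < Real.exp (2 * y) - 1 := by
    have : 1 < Real.exp (2 * y) := Real.one_lt_exp_iff.2 (by linarith)
    linarith
  have h1 : HasDerivAt (fun y : ℝ => Real.exp (2 * y) - 1) (Real.exp (2 * y) * (2 * 1)) y :=
    (((hasDerivAt_id y).const_mul 2).exp).sub_const 1
  have h2 := h1.sqrt hpos.ne'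
  have h3 := h2.sub h2.arctan
  refine h3.congr_deriv ?_
  have hs : Real.sqrt (Real.exp (2 * y) - 1) ^ 2 = Real.exp (2 * y) - 1 := Real.sq_sqrt hpos.le
  have hs0 := Real.sqrt_pos.2 hpos
  set s := Real.sqrt (Real.exp (2 * y) - 1)
  have he : Real.exp (2 * y) = s ^ 2 + 1 := by linarith
  rw [he]
  have : 1 + s ^ 2 ≠ 0 := by positivity
  field_simp
  ring

lemma key_ineq {y : ℝ} (hy : 0 < y) (v : ℝ × ℝ) :
    |v.1 + Real.sqrt (Real.exp (2 * y) - 1) * v.2| ≤ Real.exp y * elen v := by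
  have hpos : 0 ≤ Real.exp (2 * y) - 1 := by
    have : 1 < Real.exp (2 * y) := Real.one_lt_exp_iff.2 (by linarith)
    linarith
  have hs := Real.sq_sqrt hpos
  set s := Real.sqrt (Real.exp (2 * y) - 1)
  have he : Real.exp y ^ 2 = 1 + s ^ 2 := by
    rw [hs, ← Real.exp_nat_mul]; push_cast; ring
  have h0 : 0 ≤ v.1 ^ 2 + v.2 ^ 2 := by positivity
  refine abs_le_of_sq_le_sq ?_ (by unfold elen; positivity)
  rw [mul_pow, he, elen, Real.sq_sqrt h0]
  nlinarith [sq_nonneg (s * v.1 - v.2)]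

lemma lower_bound {P₁ P₂ : ℝ × ℝ} {X : ℝ → ℝ × ℝ}
    (hX : IsC1CurveIn (Ioo 0 (Real.pi / 2) ×ˢ Ioi (0:ℝ)) P₁ P₂ X) :
    |(P₂.1 + calG P₂.2) - (P₁.1 + calG P₁.2)| ≤ wLen (fun p => Real.exp p.2) X := by
  obtain ⟨hc, h1, h2⟩ := curve_data hX
  have hXc := hX.1.continuousOn
  have hy : ∀ t ∈ Icc (0:ℝ) 1, 0 < (X t).2 := fun t ht => (hX.2.1 t ht).2
  have hg : ∀ t ∈ Icc (0:ℝ) 1, HasDerivWithinAt (fun t => (X t).1 + calG (X t).2)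
      ((derivWithin X (Icc 0 1) t).1 + Real.sqrt (Real.exp (2 * (X t).2) - 1) *
        (derivWithin X (Icc 0 1) t).2) (Icc 0 1) t := by
    intro t ht
    have h3 := HasDerivAt.comp_hasDerivWithinAt (h₂ := calG) t (calG_deriv (hy t ht)) (h2 t ht)
    exact (h1 t ht).add h3
  have hcont : ContinuousOn (fun t => (derivWithin X (Icc 0 1) t).1 +
      Real.sqrt (Real.exp (2 * (X t).2) - 1) * (derivWithin X (Icc 0 1) t).2) (Icc 0 1) := by
    fun_prop
  have hint := hcont.intervalIntegrable_of_Icc (μ := MeasureTheory.volume) zero_le_one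
  have hftc := intervalIntegral.integral_eq_sub_of_hasDerivAt_of_le (zero_le_one (α := ℝ))
    (fun t ht => (hg t ht).continuousWithinAt)
    (fun t ht => (hg t (Ioo_subset_Icc_self ht)).hasDerivAt (Icc_mem_nhds ht.1 ht.2)) hint
  simp only [hX.2.2.1, hX.2.2.2] at hftc
  rw [← hftc]
  refine (intervalIntegral.abs_integral_le_integral_abs zero_le_one).trans ?_
  exact intervalIntegral.integral_mono_on zero_le_one hint.abs
    ((cont_integrand hX).intervalIntegrable_of_Icc zero_le_one)
    (fun t ht => key_ineq (hy t ht) _)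

lemma calG_grim {x : ℝ} (h0 : 0 < x) (h1 : x < Real.pi / 2) :
    x + calG (-Real.log (Real.cos x)) = Real.tan x := by
  have hc : 0 < Real.cos x := Real.cos_pos_of_mem_Ioo ⟨by linarith, h1⟩
  have ht := Real.tan_pos_of_pos_of_lt_pi_div_two h0 h1
  have : Real.exp (2 * -Real.log (Real.cos x)) - 1 = Real.tan x ^ 2 := by
    rw [two_mul, Real.exp_add, Real.exp_neg, Real.exp_log hc, Real.tan_eq_sin_div_cos]
    field_simp
    linarith [Real.sin_sq_add_cos_sq x]
  rw [calG, this, Real.sqrt_sq ht.le, Real.arctan_tan (by linarith) h1]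
  ring

lemma star_len {P₁ P₂ : ℝ × ℝ} {X : ℝ → ℝ × ℝ}
    (hX : IsC1CurveIn (Ioo 0 (Real.pi / 2) ×ˢ Ioi (0:ℝ)) P₁ P₂ X)
    (hreg : IsRegularCurve X)
    (hlevel : ∀ t ∈ Icc (0:ℝ) 1, (X t).2 = -Real.log (Real.cos (X t).1)) :
    wLen (fun p => Real.exp p.2) X ≤ |Real.tan P₂.1 - Real.tan P₁.1| := by
  obtain ⟨hc, h1, h2⟩ := curve_data hX
  have hXc := hX.1.continuousOn
  have hu : UniqueDiffOn ℝ (Icc (0:ℝ) 1) := uniqueDiffOn_Icc zero_lt_one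
  have hcos : ∀ t ∈ Icc (0:ℝ) 1, 0 < Real.cos (X t).1 := fun t ht =>
    Real.cos_pos_of_mem_Ioo ⟨by have := (hX.2.1 t ht).1.1; linarith [Real.pi_pos],
      (hX.2.1 t ht).1.2⟩
  have hy' : ∀ t ∈ Icc (0:ℝ) 1, (derivWithin X (Icc 0 1) t).2 =
      Real.tan (X t).1 * (derivWithin X (Icc 0 1) t).1 := by
    intro t ht
    have ha := (((h1 t ht).cos).log (hcos t ht).ne').neg
    have hb := (h2 t ht).congr_of_mem (fun s hs => (hlevel s hs).symm) ht
    rw [(hu t ht).eq_deriv _ hb ha, Real.tan_eq_sin_div_cos]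
    ring
  have hne : ∀ t ∈ Icc (0:ℝ) 1, (derivWithin X (Icc 0 1) t).1 ≠ 0 := by
    intro t ht h
    refine hreg t ht (Prod.ext h ?_)
    rw [hy' t ht, h]; simp
  have hval : ∀ t ∈ Icc (0:ℝ) 1, Real.exp (X t).2 * elen (derivWithin X (Icc 0 1) t) =
      |1 / Real.cos (X t).1 ^ 2 * (derivWithin X (Icc 0 1) t).1| := by
    intro t ht
    have hp := hcos t ht
    rw [hlevel t ht, Real.exp_neg, Real.exp_log hp, elen, hy' t ht]
    set a := (derivWithin X (Icc 0 1) t).1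
    have : a ^ 2 + (Real.tan (X t).1 * a) ^ 2 = (a / Real.cos (X t).1) ^ 2 := by
      rw [Real.tan_eq_sin_div_cos]
      field_simp
      rw [Real.cos_sq_add_sin_sq, mul_one]
    rw [this, Real.sqrt_sq_eq_abs, abs_div, abs_mul, abs_of_pos hp,
      abs_of_pos (show 0 < 1 / Real.cos (X t).1 ^ 2 by positivity)]
    field_simp
  have hg : ∀ t ∈ Icc (0:ℝ) 1, HasDerivWithinAt (fun t => Real.tan (X t).1)
      (1 / Real.cos (X t).1 ^ 2 * (derivWithin X (Icc 0 1) t).1) (Icc 0 1) t := by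
    intro t ht
    exact HasDerivAt.comp_hasDerivWithinAt (h₂ := Real.tan) t
      (Real.hasDerivAt_tan (hcos t ht).ne') (h1 t ht)
  have hcont : ContinuousOn (fun t => 1 / Real.cos (X t).1 ^ 2 *
      (derivWithin X (Icc 0 1) t).1) (Icc 0 1) := by
    refine ContinuousOn.mul (ContinuousOn.div continuousOn_const (by fun_prop) ?_) (by fun_prop)
    intro t ht
    exact pow_ne_zero _ (hcos t ht).ne'
  have hint := hcont.intervalIntegrable_of_Icc (μ := MeasureTheory.volume) zero_le_one
  have hftc := intervalIntegral.integral_eq_sub_of_hasDerivAt_of_le (zero_le_one (α := ℝ))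
    (fun t ht => (hg t ht).continuousWithinAt)
    (fun t ht => (hg t (Ioo_subset_Icc_self ht)).hasDerivAt (Icc_mem_nhds ht.1 ht.2)) hint
  simp only [hX.2.2.1, hX.2.2.2] at hftc
  have hsign : (∀ t ∈ Icc (0:ℝ) 1, 0 < (derivWithin X (Icc 0 1) t).1) ∨
      (∀ t ∈ Icc (0:ℝ) 1, (derivWithin X (Icc 0 1) t).1 < 0) := by
    by_contra hcon
    push Not at hcon
    obtain ⟨⟨s, hs, hs'⟩, t, ht, ht'⟩ := hcon
    have hcf : ContinuousOn (fun t => (derivWithin X (Icc 0 1) t).1) (Icc (0:ℝ) 1) := by fun_prop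
    obtain ⟨r, hr, hr0⟩ := isPreconnected_Icc.intermediate_value hs ht hcf ⟨hs', ht'⟩
    exact hne r hr hr0
  rw [← hftc]
  have hw : wLen (fun p => Real.exp p.2) X = ∫ t in (0:ℝ)..1,
      |1 / Real.cos (X t).1 ^ 2 * (derivWithin X (Icc 0 1) t).1| := by
    refine intervalIntegral.integral_congr fun t ht => ?_
    rw [uIcc_of_le zero_le_one] at ht
    exact hval t ht
  rw [hw]
  rcases hsign with h | h
  · refine le_trans (le_of_eq ?_) (le_abs_self _)
    refine intervalIntegral.integral_congr fun t ht => ?_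
    rw [uIcc_of_le zero_le_one] at ht
    have := hcos t ht
    have := h t ht
    exact abs_of_pos (by positivity)
  · refine le_trans (le_of_eq ?_) (neg_le_abs _)
    rw [← intervalIntegral.integral_neg]
    refine intervalIntegral.integral_congr fun t ht => ?_
    rw [uIcc_of_le zero_le_one] at ht
    have := hcos t ht
    exact abs_of_neg (mul_neg_of_pos_of_neg (by positivity) (h t ht))

/-- the right half of the grim reaper `y = −ln(cos x)` in
`Ω = (0, π/2) × (0, ∞)` is a weighted length-minimizer for the density `e^y`. -/
theorem statement16 (P₁ P₂ : ℝ × ℝ)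
    (hP₁ : P₁ ∈ Ioo 0 (Real.pi / 2) ×ˢ Ioi (0:ℝ))
    (hP₁' : P₁.2 = -Real.log (Real.cos P₁.1))
    (hP₂ : P₂ ∈ Ioo 0 (Real.pi / 2) ×ˢ Ioi (0:ℝ))
    (hP₂' : P₂.2 = -Real.log (Real.cos P₂.1))
    (Xstar : ℝ → ℝ × ℝ)
    (hXstar : IsC1CurveIn (Ioo 0 (Real.pi / 2) ×ˢ Ioi (0:ℝ)) P₁ P₂ Xstar)
    (hreg : IsRegularCurve Xstar)
    (hlevel : ∀ t ∈ Icc (0:ℝ) 1, (Xstar t).2 = -Real.log (Real.cos (Xstar t).1))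
    (X : ℝ → ℝ × ℝ) (hX : IsC1CurveIn (Ioo 0 (Real.pi / 2) ×ˢ Ioi (0:ℝ)) P₁ P₂ X) :
    wLen (fun p => Real.exp p.2) X ≥ wLen (fun p => Real.exp p.2) Xstar := by
  have h1 := star_len hXstar hreg hlevel
  have h2 := lower_bound hX
  rw [hP₁', hP₂', calG_grim hP₁.1.1 hP₁.1.2, calG_grim hP₂.1.1 hP₂.1.2] at h2
  exact h1.trans h2
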